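/- With j := L − ℓ, the norm of the error difference ẽ_ℓ := e ℓ − e L satisfies the two-sided bound in terms of the fine-grid error: (θ_ε^(−j) − 1) · ‖e L‖ ≤ ‖e ℓ − e L‖ ≤ (θ^(−j) + 1) · ‖e L‖, where θ^(−j) denotes (θ^j)⁻¹ and θ_ε^(−j) denotes (θ_ε^j)⁻¹. -/

import Mathlib

/-- A real sequence whose consecutive terms satisfy `a * u n ≤ u (n + 1) ≤ b * u n` for `n < k`
is squeezed between the corresponding geometric sequences. -/
theorem geometric_bounds_of_step_bounds {u : ℕ → ℝ} {a b : ℝ} (ha : 0 ≤ a) (hb : 0 ≤ b) (k : ℕ)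
    (h : ∀ n < k, a * u n ≤ u (n + 1) ∧ u (n + 1) ≤ b * u n) :
    a ^ k * u 0 ≤ u k ∧ u k ≤ b ^ k * u 0 := by
  induction k with
  | zero => simp
  | succ k ih =>
    obtain ⟨hlo, hhi⟩ := ih fun n hn => h n (by omega)
    obtain ⟨slo, shi⟩ := h k (by omega)
    constructor
    · calc a ^ (k + 1) * u 0 = a * (a ^ k * u 0) := by ring
        _ ≤ a * u k := by gcongr
        _ ≤ u (k + 1) := slo
    · calc u (k + 1) ≤ b * u k := shi
        _ ≤ b * (b ^ k * u 0) := by gcongr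
        _ = b ^ (k + 1) * u 0 := by ring


/-- With `j = L - ℓ`, the norm of the error difference `e ℓ - e L` is bounded from
above and below in terms of the fine-grid error norm. -/
theorem error_difference_fine_bounds {V : Type*} [NormedAddCommGroup V]
    (L : ℕ) (e : ℕ → V) (θ ε : ℝ)
    (hθ : 0 < θ) (hε : 0 < ε) (hθε : (1 + ε) * θ < 1)
    (ℓ : ℕ) (hℓ : ℓ ≤ L)
    (hconv : ∀ i : ℕ, ℓ ≤ i → i ≤ L →
      e (i - 1) ≠ 0 ∧ θ ≤ ‖e i‖ / ‖e (i - 1)‖ ∧ ‖e i‖ / ‖e (i - 1)‖ ≤ (1 + ε) * θ) :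
    ((((1 + ε) * θ) ^ (L - ℓ))⁻¹ - 1) * ‖e L‖ ≤ ‖e ℓ - e L‖ ∧
      ‖e ℓ - e L‖ ≤ ((θ ^ (L - ℓ))⁻¹ + 1) * ‖e L‖ := by
  have hb : 0 < (1 + ε) * θ := by positivity
  have key := geometric_bounds_of_step_bounds (u := fun n => ‖e (ℓ + n)‖) hθ.le hb.le (L - ℓ) (by
    intro n hn
    obtain ⟨hne, hlo, hhi⟩ := hconv (ℓ + (n + 1)) (by omega) (by omega)
    have hpred : ℓ + (n + 1) - 1 = ℓ + n := by omega
    rw [hpred] at hne hlo hhi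
    have hpos := norm_pos_iff.mpr hne
    exact ⟨(le_div_iff₀ hpos).mp hlo, (div_le_iff₀ hpos).mp hhi⟩)
  simp only [Nat.add_sub_cancel' hℓ, add_zero] at key
  obtain ⟨hlo, hhi⟩ := key
  have lower : (((1 + ε) * θ) ^ (L - ℓ))⁻¹ * ‖e L‖ ≤ ‖e ℓ‖ :=
    (inv_mul_le_iff₀ (pow_pos hb _)).mpr hhi
  have upper : ‖e ℓ‖ ≤ (θ ^ (L - ℓ))⁻¹ * ‖e L‖ :=
    (le_inv_mul_iff₀ (pow_pos hθ _)).mpr hlo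
  constructor
  · linarith [norm_sub_norm_le (e ℓ) (e L)]
  · linarith [norm_sub_le (e ℓ) (e L)]
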